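/- arXiv:1506.04047 — 8 statements merged into one kernel-verified Lean document; each statement's English description precedes it below -/
import Mathlib

section
/- Let G be a finite connected simple graph on a vertex set V of n players and let O be a finite set of resources with 2 ≤ |O| ≤ n. If P* is a pure Nash equilibrium of the CSR game on G, then for every player i ∈ V and every resource o ∈ O, some player j ∈ B(i, r_i(P*)) holds o, i.e., there exists j with d_G(i,j) ≤ r_i(P*) and P*(j) = o. In particular every resource is held by at least one player in P*. -/
open Finset

noncomputable section

variable {V O : Type*} [Fintype V] [DecidableEq V] [Fintype O] [DecidableEq O]

/-- Diameter of the graph: maximum graph distance between any two vertices. -/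
def csrDiam (G : SimpleGraph V) : ℕ :=
  Finset.sup Finset.univ fun i => Finset.sup Finset.univ fun j => G.dist i j

/-- Distance from player `i` to the nearest holder of resource `o` under allocation `P`;
`csrDiam G + 1` if no one holds `o`. -/
def csrDist (G : SimpleGraph V) (P : V → O) (i : V) (o : O) : ℕ :=
  if h : (Finset.univ.filter fun j => P j = o).Nonempty then
    (Finset.univ.filter fun j => P j = o).inf' h fun j => G.dist i j
  else csrDiam G + 1

/-- Cost of player `i` under allocation `P`. -/
def csrCost (G : SimpleGraph V) (P : V → O) (i : V) : ℕ :=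
  ∑ o ∈ Finset.univ.filter (fun o => o ≠ P i), csrDist G P i o

/-- Total cost of allocation `P`. -/
def csrTotal (G : SimpleGraph V) (P : V → O) : ℕ := ∑ i, csrCost G P i

/-- Radius of player `i`: distance to nearest *other* player holding the same resource;
`csrDiam G` if there is none. -/
def csrRadius (G : SimpleGraph V) (P : V → O) (i : V) : ℕ :=
  if h : (Finset.univ.filter fun j => j ≠ i ∧ P j = P i).Nonempty then
    (Finset.univ.filter fun j => j ≠ i ∧ P j = P i).inf' h fun j => G.dist i j
  else csrDiam G

/-- Ball of radius `r` (a natural number) around `i`. -/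
def csrBall (G : SimpleGraph V) (i : V) (r : ℕ) : Finset V :=
  Finset.univ.filter fun j => G.dist i j ≤ r

/-- Pure Nash equilibrium of the CSR game. -/
def csrIsNE (G : SimpleGraph V) (P : V → O) : Prop :=
  ∀ (i : V) (o : O), csrCost G P i ≤ csrCost G (Function.update P i o) i

theorem csr_core (G : SimpleGraph V) (P : V → O) (hNE : csrIsNE G P) (i k : V)
    (hki : k ≠ i) (hk : P k = P i) (o : O) :
    ∃ j : V, G.dist i j ≤ csrRadius G P i ∧ P j = o := by
  by_contra hcon
  push Not at hcon
  have hio : P i ≠ o := hcon i (by simp)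
  have hne : (Finset.univ.filter fun j => j ≠ i ∧ P j = P i).Nonempty :=
    ⟨k, by simp [hki, hk]⟩
  have hdiam : ∀ a b : V, G.dist a b ≤ csrDiam G := fun a b =>
    (Finset.le_sup (f := fun j => G.dist a j) (Finset.mem_univ b)).trans
      (Finset.le_sup (f := fun i => Finset.sup Finset.univ fun j => G.dist i j)
        (Finset.mem_univ a))
  have hr : csrRadius G P i ≤ csrDiam G := by
    unfold csrRadius
    rw [dif_pos hne]
    exact (Finset.inf'_le (s := Finset.univ.filter fun j => j ≠ i ∧ P j = P i)
      (fun j => G.dist i j) (b := k) (by simp [hki, hk])).trans (hdiam i k)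
  have h1 : csrRadius G P i < csrDist G P i o := by
    unfold csrDist
    split_ifs with h
    · rw [Finset.lt_inf'_iff]
      intro b hb
      by_contra hlt
      exact hcon b (not_lt.mp hlt) (by simpa using hb)
    · omega
  have h2 : csrDist G (Function.update P i o) i (P i) = csrRadius G P i := by
    have : (Finset.univ.filter fun j => Function.update P i o j = P i)
        = Finset.univ.filter fun j => j ≠ i ∧ P j = P i := by
      ext j
      by_cases hj : j = i
      · subst hj; simp [hio.symm]
      · simp [hj]
    unfold csrDist csrRadius
    simp only [this]
    rw [dif_pos hne, dif_pos hne]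
  have h3 : ∀ q, q ≠ P i → q ≠ o →
      csrDist G (Function.update P i o) i q = csrDist G P i q := by
    intro q hq hqo
    have : (Finset.univ.filter fun j => Function.update P i o j = q)
        = Finset.univ.filter fun j => P j = q := by
      ext j
      by_cases hj : j = i
      · subst hj; simp [hq.symm, hqo.symm]
      · simp [hj]
    unfold csrDist
    simp only [this]
  have h4 := hNE i o
  unfold csrCost at h4
  rw [← Finset.add_sum_erase (Finset.univ.filter fun q => q ≠ P i) _
      (a := o) (by simp [hio.symm]),
    ← Finset.add_sum_erase (Finset.univ.filter fun q => q ≠ Function.update P i o i) _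
      (a := P i) (by simp [hio]), h2] at h4
  have h5 : (Finset.univ.filter fun q => q ≠ Function.update P i o i).erase (P i)
      = (Finset.univ.filter fun q => q ≠ P i).erase o := by
    ext q; simp; tauto
  rw [h5, Finset.sum_congr rfl (fun q hq => h3 q (by simp at hq; exact hq.2)
    (by simp at hq; exact hq.1))] at h4
  exact absurd (Nat.le_of_add_le_add_right h4) (not_le.mpr h1)

/-- In a pure Nash equilibrium, for every player `i` and every resource `o`,
some player within distance `r_i(P*)` of `i` holds `o`. -/
theorem stmt0 (G : SimpleGraph V) (hconn : G.Connected)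
    (hO2 : 2 ≤ Fintype.card O) (hOn : Fintype.card O ≤ Fintype.card V)
    (Pstar : V → O) (hNE : csrIsNE G Pstar) :
    ∀ (i : V) (o : O), ∃ j : V, G.dist i j ≤ csrRadius G Pstar i ∧ Pstar j = o := by
  intro i o
  by_cases h : (Finset.univ.filter fun j => j ≠ i ∧ Pstar j = Pstar i).Nonempty
  · obtain ⟨k, hk⟩ := h
    simp only [Finset.mem_filter, Finset.mem_univ, true_and] at hk
    exact csr_core G Pstar hNE i k hk.1 hk.2 o
  · have hr : csrRadius G Pstar i = csrDiam G := by
      unfold csrRadius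
      rw [dif_neg h]
    have hsurj : ∃ j, Pstar j = o := by
      by_contra hns
      have hinj : ¬ Function.Injective Pstar := by
        intro hinj
        have hb : Function.Bijective Pstar :=
          (Fintype.bijective_iff_injective_and_card Pstar).2
            ⟨hinj, le_antisymm (Fintype.card_le_of_injective _ hinj) hOn⟩
        exact hns (hb.2 o)
      unfold Function.Injective at hinj
      push Not at hinj
      obtain ⟨a, b, hab, hne⟩ := hinj
      obtain ⟨j, -, hj⟩ := csr_core G Pstar hNE b a hne hab o
      exact hns ⟨j, hj⟩
    obtain ⟨j, hj⟩ := hsurj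
    refine ⟨j, ?_, hj⟩
    rw [hr]
    exact (Finset.le_sup (f := fun j => G.dist i j) (Finset.mem_univ j)).trans
      (Finset.le_sup (f := fun i => Finset.sup Finset.univ fun j => G.dist i j)
        (Finset.mem_univ i))
end
end

section
/- Let G be a finite connected simple graph on a vertex set V of n players and let O be a finite set of resources with 2 ≤ |O| < n. If P* is a pure Nash equilibrium of the CSR game on G, then for every player i the quantity r̂_i(P*) is well-defined (i.e., there exists r ≥ 1 such that B(i,r) contains two distinct players holding the same resource), and every resource o ∈ O is held by some player in B(i, 3·r̂_i(P*)). -/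
open Finset

noncomputable section

variable {V O : Type*} [Fintype V] [DecidableEq V] [Fintype O] [DecidableEq O]

/-- The set of radii `r ≥ 1` such that `B(i,r)` contains two distinct players sharing
a resource under `P`. -/
def csrHatSet (G : SimpleGraph V) (P : V → O) (i : V) : Set ℕ :=
  {r : ℕ | 1 ≤ r ∧ ∃ j k : V, j ≠ k ∧ P j = P k ∧ G.dist i j ≤ r ∧ G.dist i k ≤ r}

/-- `r̂_i(P)`: the smallest such radius. -/
def csrHatRadius (G : SimpleGraph V) (P : V → O) (i : V) : ℕ :=
  sInf (csrHatSet G P i)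

theorem csr_aux (G : SimpleGraph V) (P : V → O) (hNE : csrIsNE G P) (j k : V) (hjk : j ≠ k)
    (hP : P j = P k) (o : O) : ∃ h : V, P h = o ∧ G.dist j h ≤ G.dist j k := by
  by_cases hoa : o = P j
  · exact ⟨j, hoa.symm, by simp⟩
  have h1 := hNE j o
  set Q := Function.update P j o with hQ
  have hQj : Q j = o := by simp [hQ]
  have hQk : Q k = P j := by rw [hQ, Function.update_of_ne hjk.symm, hP]
  have e1 : csrCost G P j = csrDist G P j o
      + ∑ b ∈ univ.filter (fun b => b ≠ P j ∧ b ≠ o), csrDist G P j b := by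
    unfold csrCost
    rw [← Finset.add_sum_erase _ _ (show o ∈ univ.filter (fun b => b ≠ P j) by simp [hoa])]
    congr 2
    ext b; simp; tauto
  have e2 : csrCost G Q j = csrDist G Q j (P j)
      + ∑ b ∈ univ.filter (fun b => b ≠ P j ∧ b ≠ o), csrDist G Q j b := by
    unfold csrCost
    rw [hQj, ← Finset.add_sum_erase _ _
      (show P j ∈ univ.filter (fun b => b ≠ o) by simp [Ne.symm hoa])]
    congr 2
    ext b; simp
  have e3 : ∑ b ∈ univ.filter (fun b => b ≠ P j ∧ b ≠ o), csrDist G Q j b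
      = ∑ b ∈ univ.filter (fun b => b ≠ P j ∧ b ≠ o), csrDist G P j b := by
    apply Finset.sum_congr rfl
    intro b hb
    simp only [mem_filter, mem_univ, true_and] at hb
    have : (univ.filter fun x => Q x = b) = univ.filter fun x => P x = b := by
      ext x
      simp only [mem_filter, mem_univ, true_and]
      by_cases hx : x = j
      · subst hx
        rw [hQj]
        exact ⟨fun h => absurd h.symm hb.2, fun h => absurd h.symm hb.1⟩
      · rw [hQ, Function.update_of_ne hx]
    unfold csrDist
    simp only [this]
  have e4 : csrDist G Q j (P j) ≤ G.dist j k := by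
    have hk : k ∈ univ.filter (fun x => Q x = P j) := by simp [hQk]
    unfold csrDist
    rw [dif_pos ⟨k, hk⟩]
    exact Finset.inf'_le _ hk
  have e5 : csrDist G P j o ≤ G.dist j k := by omega
  have e6 : G.dist j k ≤ csrDiam G := by
    unfold csrDiam
    exact (Finset.le_sup (f := fun b => G.dist j b) (mem_univ k)).trans
      (Finset.le_sup (f := fun a => Finset.sup univ fun b => G.dist a b) (mem_univ j))
  unfold csrDist at e5
  split_ifs at e5 with hne
  · obtain ⟨x, hx, hxe⟩ := Finset.exists_mem_eq_inf' hne (fun x => G.dist j x)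
    exact ⟨x, by simpa using hx, hxe ▸ e5⟩
  · omega

/-- In a pure Nash equilibrium with `2 ≤ |O| < n`, for every player `i` the
quantity `r̂_i(P*)` is well-defined, and every resource is held by some player in
`B(i, 3 r̂_i(P*))`. -/
theorem stmt1 (G : SimpleGraph V) (hconn : G.Connected)
    (hO2 : 2 ≤ Fintype.card O) (hOn : Fintype.card O < Fintype.card V)
    (Pstar : V → O) (hNE : csrIsNE G Pstar) (i : V) :
    (csrHatSet G Pstar i).Nonempty ∧
      ∀ o : O, ∃ j : V, G.dist i j ≤ 3 * csrHatRadius G Pstar i ∧ Pstar j = o := by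
  have hne : (csrHatSet G Pstar i).Nonempty := by
    obtain ⟨j, k, hjk, hP⟩ := Fintype.exists_ne_map_eq_of_card_lt Pstar hOn
    exact ⟨G.dist i j + G.dist i k + 1, by omega, j, k, hjk, hP, by omega, by omega⟩
  refine ⟨hne, fun o => ?_⟩
  obtain ⟨_, j, k, hjk, hP, hj, hk⟩ := Nat.sInf_mem hne
  obtain ⟨h, ho, hd⟩ := csr_aux G Pstar hNE j k hjk hP o
  refine ⟨h, ?_, ho⟩
  have t1 : G.dist j k ≤ G.dist j i + G.dist i k := hconn.dist_triangle
  have t2 : G.dist i h ≤ G.dist i j + G.dist j h := hconn.dist_triangle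
  rw [SimpleGraph.dist_comm (u := j) (v := i)] at t1
  unfold csrHatRadius
  omega
end
end

section
/- Let G be a finite connected simple graph on a vertex set V of n players and let O be a finite set of resources with |O| ≥ 2. For every allocation Q, every player i ∈ V, and every integer r with 1 ≤ r ≤ D+1 and |B(i,r−1)| ≤ |O|, one has C_i(Q) ≥ Σ_{j ∈ B(i,r−1)} d_G(i,j) + r·(|O| − |B(i,r−1)|). -/
open Finset

noncomputable section

variable {V O : Type*} [Fintype V] [DecidableEq V] [Fintype O] [DecidableEq O]

/-- Lower bound on the cost of any player in any allocation:
`C_i(Q) ≥ Σ_{j ∈ B(i,r-1)} d(i,j) + r (|O| - |B(i,r-1)|)`. -/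
theorem stmt2 (G : SimpleGraph V) (hconn : G.Connected)
    (hO2 : 2 ≤ Fintype.card O)
    (Q : V → O) (i : V) (r : ℕ) (hr1 : 1 ≤ r) (hr2 : r ≤ csrDiam G + 1)
    (hcard : (csrBall G i (r - 1)).card ≤ Fintype.card O) :
    (∑ j ∈ csrBall G i (r - 1), G.dist i j)
        + r * (Fintype.card O - (csrBall G i (r - 1)).card)
      ≤ csrCost G Q i := by
  set B := csrBall G i (r - 1) with hB
  have hcost : csrCost G Q i = ∑ o, csrDist G Q i o := by
    unfold csrCost
    apply Finset.sum_subset (Finset.filter_subset _ _)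
    intro o _ ho
    have ho' : o = Q i := by simpa using ho
    subst ho'
    have hne : (Finset.univ.filter fun j => Q j = Q i).Nonempty := ⟨i, by simp⟩
    unfold csrDist
    rw [dif_pos hne]
    have := Finset.inf'_le (fun j => G.dist i j)
      (show i ∈ Finset.univ.filter fun j => Q j = Q i by simp)
    simp only [SimpleGraph.dist_self] at this
    exact Nat.le_zero.mp this
  have hpt : ∀ o, r - csrDist G Q i o ≤ ∑ j ∈ B with Q j = o, (r - G.dist i j) := by
    intro o
    by_cases hlt : csrDist G Q i o < r
    · unfold csrDist at hlt ⊢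
      split_ifs at hlt ⊢ with h
      · obtain ⟨j, hj, hje⟩ := Finset.exists_mem_eq_inf' h (fun j => G.dist i j)
        rw [hje] at hlt ⊢
        have hjo : Q j = o := by simpa using hj
        have hjB : j ∈ B.filter (fun j => Q j = o) := by
          simp only [hB, csrBall, Finset.mem_filter, Finset.mem_univ, true_and]
          exact ⟨by omega, hjo⟩
        exact Finset.single_le_sum (f := fun j => r - G.dist i j) (fun _ _ => Nat.zero_le _) hjB
      · omega
    · have : r - csrDist G Q i o = 0 := by omega
      rw [this]; exact Nat.zero_le _
  have hsum : ∑ o, (r - csrDist G Q i o) ≤ ∑ j ∈ B, (r - G.dist i j) := by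
    rw [← Finset.sum_fiberwise B Q (fun j => r - G.dist i j)]
    exact Finset.sum_le_sum fun o _ => hpt o
  have h1 : Fintype.card O * r ≤ ∑ o, (r - csrDist G Q i o) + ∑ o, csrDist G Q i o := by
    rw [← Finset.sum_add_distrib]
    have : ∑ _o : O, r ≤ ∑ o, (r - csrDist G Q i o + csrDist G Q i o) :=
      Finset.sum_le_sum fun o _ => by omega
    simpa using this
  have h2 : ∑ j ∈ B, (r - G.dist i j) + ∑ j ∈ B, G.dist i j = B.card * r := by
    rw [← Finset.sum_add_distrib]
    have : ∑ j ∈ B, (r - G.dist i j + G.dist i j) = ∑ j ∈ B, r := by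
      apply Finset.sum_congr rfl
      intro j hj
      have : G.dist i j ≤ r - 1 := by simpa [hB, csrBall] using hj
      omega
    rw [this]; simp
  have h3 : r * (Fintype.card O - B.card) + B.card * r = Fintype.card O * r := by
    obtain ⟨k, hk⟩ := Nat.exists_eq_add_of_le hcard
    rw [hk, Nat.add_sub_cancel_left]; ring
  rw [hcost]
  omega
end
end

section
/- Let G be a finite connected simple graph on a vertex set V of n players and let O be a finite set of resources with |O| ≥ 2. Let P be an allocation, i ∈ V a player, and ρ ≥ 1 an integer such that (a) any two distinct players in B(i,ρ−1) hold distinct resources under P, and (b) every resource o ∈ O is held by some player in B(i,3ρ). Then C_i(P) ≤ Σ_{j ∈ B(i,ρ−1)} d_G(i,j) + 3ρ·(|O| − |B(i,ρ−1)|). -/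
open Finset

noncomputable section

variable {V O : Type*} [Fintype V] [DecidableEq V] [Fintype O] [DecidableEq O]

/-- Upper bound on the cost of a player when all resources in `B(i,ρ-1)`
are distinct and every resource appears in `B(i,3ρ)`. -/
theorem stmt3 (G : SimpleGraph V) (hconn : G.Connected)
    (hO2 : 2 ≤ Fintype.card O)
    (P : V → O) (i : V) (ρ : ℕ) (hρ : 1 ≤ ρ)
    (ha : ∀ j ∈ csrBall G i (ρ - 1), ∀ j' ∈ csrBall G i (ρ - 1), j ≠ j' → P j ≠ P j')
    (hb : ∀ o : O, ∃ j ∈ csrBall G i (3 * ρ), P j = o) :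
    csrCost G P i ≤ (∑ j ∈ csrBall G i (ρ - 1), G.dist i j)
      + 3 * ρ * (Fintype.card O - (csrBall G i (ρ - 1)).card) := by
  have key : ∀ j, csrDist G P i (P j) ≤ G.dist i j := by
    intro j
    have hj : j ∈ Finset.univ.filter (fun k => P k = P j) := by simp
    unfold csrDist
    rw [dif_pos ⟨j, hj⟩]
    exact Finset.inf'_le (fun k => G.dist i k) hj
  have hinj : Set.InjOn P (csrBall G i (ρ - 1) : Set V) := by
    intro a h1 b h2 hab
    by_contra hne
    exact ha a (by simpa using h1) b (by simpa using h2) hne hab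
  have hcard : ((csrBall G i (ρ - 1)).image P).card = (csrBall G i (ρ - 1)).card :=
    Finset.card_image_of_injOn hinj
  have hle : csrCost G P i ≤ ∑ o, csrDist G P i o :=
    Finset.sum_le_sum_of_subset (Finset.filter_subset _ _)
  refine hle.trans ?_
  rw [← Finset.sum_add_sum_compl ((csrBall G i (ρ - 1)).image P)]
  refine Nat.add_le_add ?_ ?_
  · rw [Finset.sum_image hinj]
    exact Finset.sum_le_sum fun j _ => key j
  · rw [← hcard, ← Finset.card_compl, mul_comm, ← smul_eq_mul]
    refine Finset.sum_le_card_nsmul _ _ _ fun o _ => ?_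
    obtain ⟨j, hj, rfl⟩ := hb o
    exact (key j).trans (by simpa [csrBall] using hj)
end
end

section
/- Let G be a finite connected simple graph on a vertex set V of n players and let O be a finite set of resources with 2 ≤ |O| < n. If P* is a pure Nash equilibrium of the CSR game on G, then for every player i ∈ V and every allocation Q, C_i(P*) ≤ 3·C_i(Q). -/
open Finset

noncomputable section

variable {V O : Type*} [Fintype V] [DecidableEq V] [Fintype O] [DecidableEq O]

theorem csrDist_le' (G : SimpleGraph V) (P : V → O) (i v : V) : csrDist G P i (P v) ≤ G.dist i v := by
  unfold csrDist
  rw [dif_pos ⟨v, by simp⟩]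
  exact Finset.inf'_le _ (by simp)

theorem csrDist_cases' (G : SimpleGraph V) (P : V → O) (i : V) (o : O) :
    (∃ v, P v = o ∧ csrDist G P i o = G.dist i v) ∨
      ((∀ v, P v ≠ o) ∧ csrDist G P i o = csrDiam G + 1) := by
  unfold csrDist
  split_ifs with h
  · left
    obtain ⟨v, hv, e⟩ := Finset.exists_mem_eq_inf' h (fun j => G.dist i j)
    exact ⟨v, by simpa using hv, e⟩
  · right
    refine ⟨fun v hv => h ⟨v, by simp [hv]⟩, rfl⟩

theorem csr_le_diam (G : SimpleGraph V) (i j : V) : G.dist i j ≤ csrDiam G := by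
  unfold csrDiam
  exact (Finset.le_sup (f := fun j => G.dist i j) (Finset.mem_univ j)).trans
    (Finset.le_sup (f := fun i => Finset.sup Finset.univ fun j => G.dist i j) (Finset.mem_univ i))

theorem csrDist_self' (G : SimpleGraph V) (P : V → O) (i : V) : csrDist G P i (P i) = 0 := by
  have := csrDist_le' G P i i
  simpa using this

theorem csrCost_eq' (G : SimpleGraph V) (P : V → O) (i : V) :
    csrCost G P i = ∑ o, csrDist G P i o := by
  unfold csrCost
  rw [Finset.sum_filter]
  refine Finset.sum_congr rfl fun o _ => ?_
  split_ifs with h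
  · rfl
  · push Not at h
    rw [h, csrDist_self']

theorem csr_ne_step (G : SimpleGraph V) (P : V → O) (hNE : csrIsNE G P) (j k : V) (hjk : j ≠ k)
    (hP : P j = P k) (o : O) (ho : o ≠ P j) : csrDist G P j o ≤ G.dist j k := by
  have h := hNE j o
  rw [csrCost_eq', csrCost_eq'] at h
  have key : ∑ x, (csrDist G (Function.update P j o) j x + if x = o then csrDist G P j o else 0)
      ≤ ∑ x, (csrDist G P j x + if x = P j then G.dist j k else 0) := by
    refine Finset.sum_le_sum fun x _ => ?_
    by_cases hx : x = o
    · subst hx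
      have := csrDist_self' G (Function.update P j x) j
      rw [Function.update_self] at this
      simp [this]
    · by_cases hx2 : x = P j
      · have := csrDist_le' G (Function.update P j o) j k
        rw [Function.update_of_ne hjk.symm, ← hP, ← hx2] at this
        simp only [if_neg hx, if_pos hx2]
        omega
      · simp only [if_neg hx, if_neg hx2, add_zero]
        rcases csrDist_cases' G P j x with ⟨v, hv, e⟩ | ⟨_, e⟩
        · rw [e]
          have hvj : v ≠ j := by
            rintro rfl
            exact hx2 hv.symm
          have := csrDist_le' G (Function.update P j o) j v
          rwa [Function.update_of_ne hvj, hv] at this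
        · rw [e]
          rcases csrDist_cases' G (Function.update P j o) j x with ⟨v, hv, e⟩ | ⟨_, e⟩
          · rw [e]
            exact (csr_le_diam G j v).trans (Nat.le_succ _)
          · rw [e]
  simp only [Finset.sum_add_distrib, Finset.sum_ite_eq', Finset.mem_univ, if_true] at key
  omega

/-- In a pure Nash equilibrium with `2 ≤ |O| < n`, the cost of every player
is at most three times her cost in any allocation. -/
theorem stmt4 (G : SimpleGraph V) (hconn : G.Connected)
    (hO2 : 2 ≤ Fintype.card O) (hOn : Fintype.card O < Fintype.card V)
    (Pstar : V → O) (hNE : csrIsNE G Pstar) :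
    ∀ (i : V) (Q : V → O), csrCost G Pstar i ≤ 3 * csrCost G Q i := by
  intro i Q
  classical
  obtain ⟨a, b, hab, hPab⟩ := Fintype.exists_ne_map_eq_of_card_lt Pstar hOn
  have hex : ∃ R, ∃ j k, j ≠ k ∧ Pstar j = Pstar k ∧ G.dist i j ≤ R ∧ G.dist i k ≤ R :=
    ⟨csrDiam G, a, b, hab, hPab, csr_le_diam G i a, csr_le_diam G i b⟩
  obtain ⟨R, hR⟩ : ∃ R, R = Nat.find hex := ⟨_, rfl⟩
  have hRD : R ≤ csrDiam G := by
    rw [hR]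
    exact Nat.find_min' hex ⟨a, b, hab, hPab, csr_le_diam G i a, csr_le_diam G i b⟩
  have hinj : ∀ v w, G.dist i v < R → G.dist i w < R → Pstar v = Pstar w → v = w := by
    intro v w hv hw h
    by_contra hne
    have := Nat.find_min' hex (m := max (G.dist i v) (G.dist i w))
      ⟨v, w, hne, h, le_max_left _ _, le_max_right _ _⟩
    omega
  have hspec := Nat.find_spec hex
  rw [← hR] at hspec
  obtain ⟨j, k, hjk, hP, hj, hk⟩ := hspec
  have h3 : ∀ o, csrDist G Pstar i o ≤ 3 * R := by
    intro o
    by_cases ho : o = Pstar j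
    · have := csrDist_le' G Pstar i j
      rw [← ho] at this
      omega
    · have h1 := csr_ne_step G Pstar hNE j k hjk hP o ho
      have h2 := csr_le_diam G j k
      have h4 : G.dist j k ≤ G.dist j i + G.dist i k := hconn.dist_triangle
      rw [G.dist_comm (u := j) (v := i)] at h4
      rcases csrDist_cases' G Pstar j o with ⟨v, hv, e⟩ | ⟨_, e⟩
      · have h5 := csrDist_le' G Pstar i v
        rw [hv] at h5
        have h6 : G.dist i v ≤ G.dist i j + G.dist j v := hconn.dist_triangle
        omega
      · omega
  have hA : ∑ o, (R - csrDist G Q i o) ≤ ∑ v, (R - G.dist i v) := by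
    rw [← Finset.sum_fiberwise (s := Finset.univ) (g := Q)]
    refine Finset.sum_le_sum fun o _ => ?_
    rcases csrDist_cases' G Q i o with ⟨v, hv, e⟩ | ⟨_, e⟩
    · rw [e]
      exact Finset.single_le_sum (f := fun v => R - G.dist i v) (fun _ _ => Nat.zero_le _)
        (by simp [hv])
    · rw [e, Nat.sub_eq_zero_of_le (by omega)]
      exact Nat.zero_le _
  have hB : ∑ v, (R - G.dist i v) ≤ ∑ o, (R - csrDist G Pstar i o) := by
    have e1 : ∑ v, (R - G.dist i v)
        = ∑ v ∈ Finset.univ.filter (fun v => G.dist i v < R), (R - G.dist i v) := by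
      rw [Finset.sum_filter]
      refine Finset.sum_congr rfl fun v _ => ?_
      split_ifs <;> omega
    rw [e1]
    calc _ ≤ ∑ v ∈ Finset.univ.filter (fun v => G.dist i v < R), (R - csrDist G Pstar i (Pstar v)) :=
          Finset.sum_le_sum fun v _ => Nat.sub_le_sub_left (csrDist_le' G Pstar i v) R
      _ = ∑ o ∈ (Finset.univ.filter (fun v => G.dist i v < R)).image Pstar,
            (R - csrDist G Pstar i o) := by
          rw [Finset.sum_image]
          intro v hv w hw h
          exact hinj v w (by simpa using hv) (by simpa using hw) h
      _ ≤ _ := Finset.sum_le_sum_of_subset (Finset.subset_univ _)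
  have hC : ∀ P : V → O, ∑ o, (R - csrDist G P i o) + ∑ o, min (csrDist G P i o) R
      = ∑ _o : O, R := by
    intro P
    rw [← Finset.sum_add_distrib]
    exact Finset.sum_congr rfl fun o _ => by omega
  have hQ := hC Q
  have hS := hC Pstar
  have h5 : ∑ o, csrDist G Pstar i o ≤ 3 * ∑ o, min (csrDist G Pstar i o) R := by
    rw [Finset.mul_sum]
    exact Finset.sum_le_sum fun o _ => by have := h3 o; omega
  have h6 : ∑ o, min (csrDist G Q i o) R ≤ ∑ o, csrDist G Q i o :=
    Finset.sum_le_sum fun o _ => min_le_left _ _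
  rw [csrCost_eq', csrCost_eq']
  omega
end
end

section
/- (Radius monotonicity under a unilateral change.) Let G be a finite connected simple graph on a vertex set V of n players and let O be a finite set of resources. Let P and P' be allocations that agree on every player except possibly a player i (i.e., P'(k) = P(k) for all k ≠ i). Then for every player k ≠ i, r_k(P') ≥ min(r_k(P), r_i(P')). -/
open Finset

noncomputable section

variable {V O : Type*} [Fintype V] [DecidableEq V] [Fintype O] [DecidableEq O]

theorem csrRadius_le_dist (G : SimpleGraph V) (P : V → O) (k j : V) (hj : j ≠ k)
    (h : P j = P k) : csrRadius G P k ≤ G.dist k j := by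
  have hm : j ∈ Finset.univ.filter fun j => j ≠ k ∧ P j = P k := by simp [hj, h]
  unfold csrRadius
  rw [dif_pos ⟨j, hm⟩]
  exact Finset.inf'_le (fun j => G.dist k j) hm

theorem dist_le_csrDiam (G : SimpleGraph V) (k j : V) : G.dist k j ≤ csrDiam G := by
  unfold csrDiam
  exact le_trans (Finset.le_sup (f := fun j => G.dist k j) (Finset.mem_univ j))
    (Finset.le_sup (f := fun i => Finset.sup Finset.univ fun j => G.dist i j)
      (Finset.mem_univ k))

theorem csrRadius_le_csrDiam (G : SimpleGraph V) (P : V → O) (k : V) :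
    csrRadius G P k ≤ csrDiam G := by
  by_cases h : (Finset.univ.filter fun j => j ≠ k ∧ P j = P k).Nonempty
  · obtain ⟨j, hj⟩ := h
    simp only [Finset.mem_filter, Finset.mem_univ, true_and] at hj
    exact (csrRadius_le_dist G P k j hj.1 hj.2).trans (dist_le_csrDiam G k j)
  · unfold csrRadius
    rw [dif_neg h]

/-- Radius monotonicity under a unilateral change: if `P'` agrees with `P`
except possibly at player `i`, then for every `k ≠ i`, `r_k(P') ≥ min(r_k(P), r_i(P'))`. -/
theorem stmt10 (G : SimpleGraph V) (hconn : G.Connected)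
    (P P' : V → O) (i : V) (hagree : ∀ k : V, k ≠ i → P' k = P k) :
    ∀ k : V, k ≠ i → min (csrRadius G P k) (csrRadius G P' i) ≤ csrRadius G P' k := by
  intro k hk
  by_cases h : (Finset.univ.filter fun j => j ≠ k ∧ P' j = P' k).Nonempty
  · have e : csrRadius G P' k =
        (Finset.univ.filter fun j => j ≠ k ∧ P' j = P' k).inf' h fun j => G.dist k j := by
      unfold csrRadius
      rw [dif_pos h]
    rw [e]
    refine Finset.le_inf' _ _ fun j hj => ?_
    simp only [Finset.mem_filter, Finset.mem_univ, true_and] at hj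
    by_cases hji : j = i
    · subst hji
      refine (min_le_right _ _).trans ?_
      rw [G.dist_comm]
      exact csrRadius_le_dist G P' j k hk hj.2.symm
    · refine (min_le_left _ _).trans (csrRadius_le_dist G P k j hj.1 ?_)
      rw [← hagree j hji, ← hagree k hk]
      exact hj.2
  · have e : csrRadius G P' k = csrDiam G := by
      unfold csrRadius
      rw [dif_neg h]
    rw [e]
    exact (min_le_left _ _).trans (csrRadius_le_csrDiam G P k)
end
end

section
/- (Cost-change equals radius-change for a unilateral deviation.) Let G be a finite connected simple graph on a vertex set V of n players and let O be a finite set of resources. Let P and P̃ be allocations that agree on every player except player i, with P(i) ≠ P̃(i). Assume there exists a player j ≠ i with P(j) = P(i) and there exists a player j' ≠ i with P(j') = P̃(i). Then C_i(P) − C_i(P̃) = r_i(P̃) − r_i(P). -/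
open Finset

noncomputable section

variable {V O : Type*} [Fintype V] [DecidableEq V] [Fintype O] [DecidableEq O]

theorem aux_radius (G : SimpleGraph V) (P Pt : V → O) (i : V)
    (hagree : ∀ k : V, k ≠ i → Pt k = P k) (hne : P i ≠ Pt i)
    (hnew : ∃ j' : V, j' ≠ i ∧ P j' = Pt i) :
    csrDist G P i (Pt i) = csrRadius G Pt i := by
  have hs : (Finset.univ.filter fun j => P j = Pt i)
      = (Finset.univ.filter fun j => j ≠ i ∧ Pt j = Pt i) := by
    ext j
    simp only [Finset.mem_filter, Finset.mem_univ, true_and]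
    constructor
    · intro h
      have hj : j ≠ i := by
        rintro rfl
        exact hne h
      exact ⟨hj, (hagree j hj).trans h⟩
    · rintro ⟨hj, h⟩
      exact (hagree j hj).symm.trans h
  have hn : (Finset.univ.filter fun j => P j = Pt i).Nonempty := by
    obtain ⟨j, _, h⟩ := hnew
    exact ⟨j, by simp [h]⟩
  have hn' := hn
  rw [hs] at hn'
  unfold csrDist csrRadius
  rw [dif_pos hn, dif_pos hn']
  simp only [hs]

theorem aux_dist (G : SimpleGraph V) (P Pt : V → O) (i : V)
    (hagree : ∀ k : V, k ≠ i → Pt k = P k) (o : O) (h1 : o ≠ P i) (h2 : o ≠ Pt i) :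
    csrDist G P i o = csrDist G Pt i o := by
  have hs : (Finset.univ.filter fun j => P j = o)
      = (Finset.univ.filter fun j => Pt j = o) := by
    ext j
    simp only [Finset.mem_filter, Finset.mem_univ, true_and]
    by_cases hj : j = i
    · subst hj
      exact ⟨fun h => (h1 h.symm).elim, fun h => (h2 h.symm).elim⟩
    · rw [hagree j hj]
  unfold csrDist
  simp only [hs]

theorem aux_cost (G : SimpleGraph V) (P Pt : V → O) (i : V)
    (hne : P i ≠ Pt i) :
    csrCost G P i = csrDist G P i (Pt i) +
      ∑ o ∈ Finset.univ.filter (fun o => o ≠ P i ∧ o ≠ Pt i), csrDist G P i o := by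
  unfold csrCost
  rw [← Finset.add_sum_erase _ _ (a := Pt i) (by simpa using hne.symm)]
  congr 1
  apply Finset.sum_congr _ (fun _ _ => rfl)
  ext o
  simp [and_comm]

/-- Cost-change equals radius-change for a unilateral deviation:
if `P̃` agrees with `P` except at `i`, `P(i) ≠ P̃(i)`, and both `P(i)` and `P̃(i)` are held
by some player other than `i`, then `C_i(P) - C_i(P̃) = r_i(P̃) - r_i(P)`. -/
theorem stmt13 (G : SimpleGraph V) (hconn : G.Connected)
    (P Pt : V → O) (i : V)
    (hagree : ∀ k : V, k ≠ i → Pt k = P k) (hne : P i ≠ Pt i)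
    (hold : ∃ j : V, j ≠ i ∧ P j = P i)
    (hnew : ∃ j' : V, j' ≠ i ∧ P j' = Pt i) :
    (csrCost G P i : ℤ) - (csrCost G Pt i : ℤ) =
      (csrRadius G Pt i : ℤ) - (csrRadius G P i : ℤ) := by
  have e1 := aux_cost G P Pt i hne
  have e2 := aux_cost G Pt P i hne.symm
  have r1 := aux_radius G P Pt i hagree hne hnew
  have r2 := aux_radius G Pt P i (fun k hk => (hagree k hk).symm) hne.symm
    (by obtain ⟨j, hj, h⟩ := hold; exact ⟨j, hj, (hagree j hj).trans h⟩)
  have hsum : ∑ o ∈ Finset.univ.filter (fun o => o ≠ P i ∧ o ≠ Pt i), csrDist G P i o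
      = ∑ o ∈ Finset.univ.filter (fun o => o ≠ Pt i ∧ o ≠ P i), csrDist G Pt i o := by
    apply Finset.sum_congr
    · ext o
      simp [and_comm]
    · intro o ho
      simp only [Finset.mem_filter, Finset.mem_univ, true_and] at ho
      exact aux_dist G P Pt i hagree o ho.2 ho.1
  rw [e1, e2, r1, r2, hsum]
  push_cast
  ring
end
end

section
/- (Distinct resources near every node under ε-stability.) Let G be a finite connected simple graph on a vertex set V of n players, let O be a finite set of resources, and let ε > 1 be real. Let P̄ be an ε-stable allocation, and for a player i let γ_i denote the resource-radius of i under P̄. Then any two distinct players j, j' with d_G(i,j) ≤ (γ_i − 1)/(2ε+1) and d_G(i,j') ≤ (γ_i − 1)/(2ε+1) satisfy P̄(j) ≠ P̄(j'). -/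
open Finset

noncomputable section

variable {V O : Type*} [Fintype V] [DecidableEq V] [Fintype O] [DecidableEq O]

/-- An allocation is `ε`-stable if for every player `i` and every resource `o`, some
player holding `o` lies within distance strictly less than `ε · r_i(P)` of `i`. -/
def csrEpsStable (G : SimpleGraph V) (ε : ℝ) (P : V → O) : Prop :=
  ∀ (i : V) (o : O), ∃ j : V, P j = o ∧ (G.dist i j : ℝ) < ε * (csrRadius G P i : ℝ)

/-- The resource-radius of player `i` under `P`: the smallest `ρ` such that every
resource is held by some player within distance `ρ` of `i`. -/
def csrResRadius (G : SimpleGraph V) (P : V → O) (i : V) : ℕ :=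
  sInf {ρ : ℕ | ∀ o : O, ∃ j : V, P j = o ∧ G.dist i j ≤ ρ}

/-- Under an `ε`-stable allocation, any two distinct players within
distance `(γ_i - 1)/(2ε + 1)` of `i` hold distinct resources. -/
theorem stmt14 (G : SimpleGraph V) (hconn : G.Connected)
    (ε : ℝ) (hε : 1 < ε) (Pbar : V → O) (hstable : csrEpsStable G ε Pbar)
    (i j j' : V) (hjj' : j ≠ j')
    (hj : (G.dist i j : ℝ) ≤ ((csrResRadius G Pbar i : ℝ) - 1) / (2 * ε + 1))
    (hj' : (G.dist i j' : ℝ) ≤ ((csrResRadius G Pbar i : ℝ) - 1) / (2 * ε + 1)) :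
    Pbar j ≠ Pbar j' := by
  intro heq
  have hpos : (0 : ℝ) < 2 * ε + 1 := by linarith
  rw [le_div_iff₀ hpos] at hj hj'
  have h0 : (0 : ℝ) ≤ (G.dist i j : ℝ) * (2 * ε + 1) := by positivity
  have hg1 : 1 ≤ csrResRadius G Pbar i := by
    have : (1 : ℝ) ≤ (csrResRadius G Pbar i : ℝ) := by linarith
    exact_mod_cast this
  have hnot : csrResRadius G Pbar i - 1 ∉
      {ρ : ℕ | ∀ o : O, ∃ j : V, Pbar j = o ∧ G.dist i j ≤ ρ} := by
    apply Nat.notMem_of_lt_sInf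
    change csrResRadius G Pbar i - 1 < csrResRadius G Pbar i
    omega
  apply hnot
  intro o
  obtain ⟨k, hk, hd⟩ := hstable j o
  refine ⟨k, hk, ?_⟩
  have hr : csrRadius G Pbar j ≤ G.dist j j' := by
    have hmem : j' ∈ Finset.univ.filter fun k => k ≠ j ∧ Pbar k = Pbar j := by
      simp [hjj'.symm, heq]
    unfold csrRadius
    rw [dif_pos ⟨j', hmem⟩]
    exact Finset.inf'_le (fun k => G.dist j k) hmem
  have t1 : G.dist j j' ≤ G.dist j i + G.dist i j' := hconn.dist_triangle
  have t2 : G.dist i k ≤ G.dist i j + G.dist j k := hconn.dist_triangle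
  rw [G.dist_comm (u := j) (v := i)] at t1
  have hr' : (csrRadius G Pbar j : ℝ) ≤ G.dist i j + G.dist i j' := by
    exact_mod_cast hr.trans t1
  have t2' : (G.dist i k : ℝ) ≤ G.dist i j + G.dist j k := by exact_mod_cast t2
  have hm : ε * (csrRadius G Pbar j : ℝ) ≤ ε * (G.dist i j + G.dist i j') :=
    mul_le_mul_of_nonneg_left hr' (by linarith)
  have hmain : (G.dist i k : ℝ) ≤ (csrResRadius G Pbar i : ℝ) - 1 := by
    have hlt : (G.dist i k : ℝ) ≤ G.dist i j + ε * (G.dist i j + G.dist i j') := by linarith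
    rcases le_total (G.dist i j : ℝ) (G.dist i j' : ℝ) with h | h
    · nlinarith
    · nlinarith
  have : (G.dist i k : ℝ) ≤ ((csrResRadius G Pbar i - 1 : ℕ) : ℝ) := by
    rw [Nat.cast_sub hg1]; simpa using hmain
  exact_mod_cast this
end
end
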